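/- Let p be a prime number and let c be a nonempty list of integers with every entry ≥ 2 such that s(c) = p. If the polynomial 𝓢(c), regarded as an element of ℚ[q], factors as 𝓢(c) = f·g with f, g ∈ ℚ[q] both of degree ≥ 1, then deg f ≥ 7 and deg g ≥ 7. (That is, if 𝓢_{a/p}(q) is reducible over ℚ, then every nonconstant proper factor has degree at least 7.) -/

import Mathlib

open Polynomial

/-- The `q`-deformation `[n]_q = 1 + q + ⋯ + q^{n-1}` of a nonnegative integer. -/
noncomputable def qNat (n : ℕ) : Polynomial ℤ := (Finset.range n).sum fun i => X ^ i

/-- The matrix `M_q⁻(c) = (([c]_q, -q^{c-1}), (1, 0))` over `ℤ[q]`. -/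
noncomputable def MqNeg (c : ℕ) : Matrix (Fin 2) (Fin 2) (Polynomial ℤ) :=
  !![qNat c, -(X ^ (c - 1)); 1, 0]

/-- `𝓡(c)`: the (0,0) entry of `M_q⁻(c₁)⋯M_q⁻(c_l)`. -/
noncomputable def Rpoly (L : List ℕ) : Polynomial ℤ := ((L.map MqNeg).prod) 0 0

/-- `𝓢(c)`: the (1,0) entry of `M_q⁻(c₁)⋯M_q⁻(c_l)`. -/
noncomputable def Spoly (L : List ℕ) : Polynomial ℤ := ((L.map MqNeg).prod) 1 0

/-- `r(c) = 𝓡(c)(1)`. -/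
noncomputable def rNum (L : List ℕ) : ℤ := (Rpoly L).eval 1

/-- `s(c) = 𝓢(c)(1)`. -/
noncomputable def sNum (L : List ℕ) : ℤ := (Spoly L).eval 1

/-- The values at `q = 3` of `𝓡` and `𝓢`, recovered from their values `r` and `s` at `q = 1` by the
subtractive Euclidean algorithm; the first argument bounds the number of steps. -/
def valuesAtThree : ℕ → ℤ → ℤ → ℤ × ℤ
  | 0, _, _ => (0, 0)
  | n + 1, r, s =>
    if r = 2 then (4, 1)
    else if r ≤ 2 * s then
      match valuesAtThree n s (2 * s - r) with
      | (a, b) => (4 * a - 3 * b, a)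
    else
      match valuesAtThree n (r - s) s with
      | (a, b) => (3 * a + b, b)

/-- The polynomials `1 + a₁ q + ⋯ + a₅ q⁵ + e q⁶` are determined by `e` and by their values `m`, `i`
and `w` at `-1`, at `√-1` and at a primitive cube root of unity; here all choices of units are
examined. -/
theorem candidate_check : ∀ e ∈ [(0 : ℤ), 1], ∀ m ∈ [(1 : ℤ), -1],
    ∀ i ∈ [((1 : ℤ), (0 : ℤ)), (-1, 0), (0, 1), (0, -1)],
    ∀ w ∈ [((1 : ℤ), (0 : ℤ)), (-1, 0), (0, 1), (0, -1), (1, 1), (-1, -1)],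
    ∀ a₂ ∈ [(6 + 4 * e - m - i.1 - 3 * i.2 - 4 * w.1 + 2 * w.2) / 2],
    ∀ a₄ ∈ [a₂ + e + i.1 - 1], ∀ a₅ ∈ [a₂ + i.1 + i.2 + w.1 - w.2 - 2],
    ∀ a₃ ∈ [a₅ + w.1 - 1 + a₂ - e], ∀ a₁ ∈ [a₅ + w.2 + 1 - e - i.1],
    0 < 1 + a₁ * 3 + a₂ * 9 + a₃ * 27 + a₄ * 81 + a₅ * 243 + e * 729 →
    1 + a₁ + a₂ + a₃ + a₄ + a₅ + e ≤ 41 ∧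
    (1 + a₁ + a₂ + a₃ + a₄ + a₅ + e = 1 →
      a₁ = 0 ∧ a₂ = 0 ∧ a₃ = 0 ∧ a₄ = 0 ∧ a₅ = 0 ∧ e = 0) ∧
    ∀ s ∈ List.range (1 + a₁ + a₂ + a₃ + a₄ + a₅ + e).toNat,
      1 + a₁ * 3 + a₂ * 9 + a₃ * 27 + a₄ * 81 + a₅ * 243 + e * 729 ∣
        (valuesAtThree 41 (1 + a₁ + a₂ + a₃ + a₄ + a₅ + e) s).1 →
      (valuesAtThree 41 (1 + a₁ + a₂ + a₃ + a₄ + a₅ + e) s).1 < 6561 := by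
  decide +kernel

theorem Rpoly_nil : Rpoly [] = 1 := by simp [Rpoly]

theorem Spoly_nil : Spoly [] = 0 := by simp [Spoly]

theorem Rpoly_cons (c : ℕ) (L : List ℕ) :
    Rpoly (c :: L) = qNat c * Rpoly L - X ^ (c - 1) * Spoly L := by
  simp [Rpoly, Spoly, MqNeg, Matrix.mul_apply, Fin.sum_univ_two, sub_eq_add_neg]

theorem Spoly_cons (c : ℕ) (L : List ℕ) : Spoly (c :: L) = Rpoly L := by
  simp [Rpoly, Spoly, MqNeg, Matrix.mul_apply, Fin.sum_univ_two]

theorem qNat_succ (n : ℕ) : qNat (n + 1) = X * qNat n + 1 := by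
  simp [qNat, Finset.sum_range_succ', Finset.mul_sum, pow_succ']

/-- Induction along the generators: a relation which holds for the pair attached to `[2]`, and is
stable under prepending an entry `2` and under increasing the first entry by one, holds for all
pairs `(𝓡(c), 𝓢(c))`. -/
theorem Rpoly_Spoly_induction {Q : ℤ[X] → ℤ[X] → Prop} (start : Q (1 + X) 1)
    (two : ∀ A B, Q A B → Q ((1 + X) * A - X * B) A) (up : ∀ A B, Q A B → Q (X * A + B) B)
    (L : List ℕ) (hL : L ≠ []) (hL2 : ∀ y ∈ L, 2 ≤ y) : Q (Rpoly L) (Spoly L) := by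
  induction L with
  | nil => exact absurd rfl hL
  | cons c L ih =>
    have hc : 2 ≤ c := hL2 c (by simp)
    rw [Spoly_cons]
    induction c, hc using Nat.le_induction with
    | base =>
      have h : Rpoly (2 :: L) = (1 + X) * Rpoly L - X * Spoly L := by
        simp [Rpoly_cons, qNat, Finset.sum_range_succ]
      rw [h]
      rcases eq_or_ne L [] with rfl | hL'
      · simpa [Rpoly_nil, Spoly_nil] using start
      · exact two _ _ (ih hL' fun y hy => hL2 y (by simp [hy]))
    | succ c hc ihc =>
      obtain ⟨c, rfl⟩ : ∃ k, c = k + 1 := ⟨c - 1, by omega⟩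
      have h : Rpoly ((c + 1 + 1) :: L) = X * Rpoly ((c + 1) :: L) + Rpoly L := by
        simp only [Rpoly_cons, qNat_succ (c + 1), Nat.add_sub_cancel, pow_succ]
        ring
      rw [h]
      refine up _ _ (ihc (by simp) fun y hy => ?_)
      rcases List.mem_cons.1 hy with rfl | hy
      · exact hc
      · exact hL2 y (by simp [hy])

theorem Rpoly_monic (L : List ℕ) (hL2 : ∀ y ∈ L, 2 ≤ y) : (Rpoly L).Monic := by
  rcases eq_or_ne L [] with rfl | hL
  · rw [Rpoly_nil]; exact monic_one
  refine (Rpoly_Spoly_induction (Q := fun A B => A.Monic ∧ B.degree < A.degree) ?_ ?_ ?_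
    L hL hL2).1
  · have h : (1 + X : ℤ[X]) = X + C 1 := by simp [add_comm]
    rw [h]
    exact ⟨monic_X_add_C 1, by rw [degree_X_add_C]; simp⟩
  · rintro A B ⟨hA, hB⟩
    have hX : (1 + X : ℤ[X]).Monic := by
      simpa [add_comm] using monic_X_add_C (1 : ℤ)
    have hdX : (1 + X : ℤ[X]).degree = 1 := by
      simpa [add_comm] using degree_X_add_C (1 : ℤ)
    have hlt : (X * B).degree < ((1 + X) * A).degree := by
      rw [degree_mul, degree_mul, hdX, degree_X]
      exact WithBot.add_lt_add_left (by simp) hB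
    refine ⟨(hX.mul hA).sub_of_left hlt, ?_⟩
    rw [degree_sub_eq_left_of_degree_lt hlt, degree_mul, hdX, degree_eq_natDegree hA.ne_zero]
    norm_cast
    omega
  · rintro A B ⟨hA, hB⟩
    have hlt : B.degree < (X * A).degree := by
      refine hB.trans ?_
      rw [degree_mul, degree_X, degree_eq_natDegree hA.ne_zero]
      norm_cast
      omega
    exact ⟨(monic_X.mul hA).add_of_left hlt, by rwa [degree_add_eq_left_of_degree_lt hlt]⟩

theorem Rpoly_coeff_nonneg (L : List ℕ) (hL2 : ∀ y ∈ L, 2 ≤ y) (n : ℕ) :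
    0 ≤ (Rpoly L).coeff n := by
  rcases eq_or_ne L [] with rfl | hL
  · rw [Rpoly_nil, coeff_one]; split <;> simp
  have key := Rpoly_Spoly_induction
    (Q := fun A B => ∀ n, 0 ≤ B.coeff n ∧ B.coeff n ≤ A.coeff n) ?_ ?_ ?_ L hL hL2
  · exact (key n).1.trans (key n).2
  · intro n
    simp only [coeff_add, coeff_one, coeff_X]
    split <;> split <;> simp
  · intro A B h n
    refine ⟨(h n).1.trans (h n).2, ?_⟩
    have e : (1 + X) * A - X * B = A + X * (A - B) := by ring
    rw [e, coeff_add]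
    cases n with
    | zero => simp
    | succ n =>
      rw [coeff_X_mul, coeff_sub]
      linarith [(h n).2]
  · intro A B h n
    refine ⟨(h n).1, ?_⟩
    cases n with
    | zero => simp
    | succ n =>
      rw [coeff_add, coeff_X_mul]
      linarith [(h n).1.trans (h n).2]

theorem Rpoly_eval_zero (L : List ℕ) (hL2 : ∀ y ∈ L, 2 ≤ y) : (Rpoly L).eval 0 = 1 := by
  rcases eq_or_ne L [] with rfl | hL
  · simp [Rpoly_nil]
  refine (Rpoly_Spoly_induction (Q := fun A B => A.eval 0 = 1 ∧ B.eval 0 = 1) ?_ ?_ ?_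
    L hL hL2).1 <;> simp +contextual

theorem Rpoly_eval_neg_one (L : List ℕ) (hL2 : ∀ y ∈ L, 2 ≤ y) :
    (Rpoly L).eval (-1) ^ 2 ≤ 1 := by
  rcases eq_or_ne L [] with rfl | hL
  · simp [Rpoly_nil]
  have key := Rpoly_Spoly_induction
    (Q := fun A B => A.eval (-1) ^ 2 + B.eval (-1) ^ 2 - A.eval (-1) * B.eval (-1) = 1)
    (by simp) (fun A B h => by simp; linarith) (fun A B h => by simp; linarith) L hL hL2
  by_contra! h
  nlinarith [sq_nonneg ((Rpoly L).eval (-1) - 2 * (Spoly L).eval (-1))]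

/-- The square root of `-1` in the Gaussian integers. -/
abbrev gaussUnit : QuadraticAlgebra ℤ (-1) 0 := ⟨0, 1⟩

/-- A primitive cube root of unity in the Eisenstein integers. -/
abbrev eisensteinUnit : QuadraticAlgebra ℤ (-1) (-1) := ⟨0, 1⟩

open QuadraticAlgebra in
theorem norm_Rpoly_gaussUnit (L : List ℕ) (hL2 : ∀ y ∈ L, 2 ≤ y) :
    (aeval gaussUnit (Rpoly L)).norm ≤ 2 := by
  rcases eq_or_ne L [] with rfl | hL
  · simp [Rpoly_nil]
  have key := Rpoly_Spoly_induction
    (Q := fun A B => ∀ x y, aeval gaussUnit A = x → aeval gaussUnit B = y →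
      x.norm + y.norm - x.re * y.re - x.im * y.im + x.re * y.im - x.im * y.re = 1)
    ?_ ?_ ?_ L hL hL2
  · have h := key _ _ rfl rfl
    generalize aeval gaussUnit (Rpoly L) = x at *
    generalize aeval gaussUnit (Spoly L) = y at *
    simp only [norm_def] at *
    nlinarith [sq_nonneg (2 * y.re - x.re - x.im), sq_nonneg (2 * y.im - x.im + x.re)]
  · rintro x y rfl rfl
    simp [norm_def]
  · rintro A B h x y rfl rfl
    have h := h _ _ rfl rfl
    simp [norm_def] at *
    linarith
  · rintro A B h x y rfl rfl
    have h := h _ _ rfl rfl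
    simp [norm_def] at *
    linarith

open QuadraticAlgebra in
theorem norm_Rpoly_eisensteinUnit (L : List ℕ) (hL2 : ∀ y ∈ L, 2 ≤ y) :
    (aeval eisensteinUnit (Rpoly L)).norm ≤ 1 := by
  rcases eq_or_ne L [] with rfl | hL
  · simp [Rpoly_nil]
  have key := Rpoly_Spoly_induction
    (Q := fun A B => ∀ x y, aeval eisensteinUnit A = x → aeval eisensteinUnit B = y →
      x.norm + y.norm - x.re * y.re + x.re * y.im - x.im * y.im = 1)
    ?_ ?_ ?_ L hL hL2
  · have h := key _ _ rfl rfl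
    generalize aeval eisensteinUnit (Rpoly L) = x at *
    generalize aeval eisensteinUnit (Spoly L) = y at *
    simp only [norm_def] at *
    by_contra! h2
    nlinarith [sq_nonneg (2 * y.re - y.im - x.re), sq_nonneg (3 * y.im + x.re - 2 * x.im)]
  · rintro x y rfl rfl
    simp [norm_def]
  · rintro A B h x y rfl rfl
    have h := h _ _ rfl rfl
    simp [norm_def] at *
    linarith
  · rintro A B h x y rfl rfl
    have h := h _ _ rfl rfl
    simp [norm_def] at *
    linarith

theorem Rpoly_eval_three (L : List ℕ) (hL : L ≠ []) (hL2 : ∀ y ∈ L, 2 ≤ y) (n : ℕ)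
    (hn : (Rpoly L).eval 1 ≤ n) :
    0 ≤ (Spoly L).eval 1 ∧ (Spoly L).eval 1 < (Rpoly L).eval 1 ∧
    (Rpoly L).eval 3 = (valuesAtThree n ((Rpoly L).eval 1) ((Spoly L).eval 1)).1 := by
  have key := Rpoly_Spoly_induction
    (Q := fun A B => 0 < B.eval 1 ∧ B.eval 1 < A.eval 1 ∧ ∀ n : ℕ, A.eval 1 ≤ n →
      valuesAtThree n (A.eval 1) (B.eval 1) = (A.eval 3, B.eval 3)) ?_ ?_ ?_ L hL hL2
  · exact ⟨key.1.le, key.2.1, by rw [key.2.2 n hn]⟩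
  · refine ⟨by simp, by simp, fun n hn => ?_⟩
    simp at hn
    obtain ⟨n, rfl⟩ : ∃ k, n = k + 1 := ⟨n - 1, by omega⟩
    simp [valuesAtThree]
  · rintro A B ⟨h0, h1, h⟩
    simp only [eval_sub, eval_mul, eval_add, eval_one, eval_X]
    refine ⟨by linarith, by linarith, fun n hn => ?_⟩
    obtain ⟨n, rfl⟩ : ∃ k, n = k + 1 := ⟨n - 1, by omega⟩
    rw [valuesAtThree, if_neg (by omega), if_pos (by omega)]
    have e : 2 * A.eval 1 - ((1 + 1) * A.eval 1 - 1 * B.eval 1) = B.eval 1 := by ring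
    rw [e, h n (by push_cast at hn; omega)]
    norm_num
  · rintro A B ⟨h0, h1, h⟩
    simp only [eval_mul, eval_add, eval_X]
    refine ⟨h0, by linarith, fun n hn => ?_⟩
    obtain ⟨n, rfl⟩ : ∃ k, n = k + 1 := ⟨n - 1, by omega⟩
    rw [valuesAtThree, if_neg (by omega), if_neg (by omega)]
    have e : 1 * A.eval 1 + B.eval 1 - B.eval 1 = A.eval 1 := by ring
    rw [e, h n (by push_cast at hn; omega)]

theorem exists_re_add_im_aeval_gaussUnit (F : ℤ[X]) :
    ∃ k, (aeval gaussUnit F).re + (aeval gaussUnit F).im = F.eval 1 + 2 * k := by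
  obtain ⟨G, hG⟩ := X_sub_C_dvd_sub_C_eval (p := F) (a := (1 : ℤ))
  refine ⟨-(aeval gaussUnit G).im, ?_⟩
  rw [sub_eq_iff_eq_add] at hG
  have h := congrArg (aeval gaussUnit) hG
  rw [h]
  simp [QuadraticAlgebra.re_one, QuadraticAlgebra.im_one]
  ring

theorem exists_re_add_im_aeval_eisensteinUnit (F : ℤ[X]) :
    ∃ k, (aeval eisensteinUnit F).re + (aeval eisensteinUnit F).im = F.eval 1 + 3 * k := by
  obtain ⟨G, hG⟩ := X_sub_C_dvd_sub_C_eval (p := F) (a := (1 : ℤ))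
  refine ⟨-(aeval eisensteinUnit G).im, ?_⟩
  rw [sub_eq_iff_eq_add] at hG
  have h := congrArg (aeval eisensteinUnit) hG
  rw [h]
  simp [QuadraticAlgebra.re_one, QuadraticAlgebra.im_one]
  ring

theorem exists_eval_neg_one (F : ℤ[X]) : ∃ k, F.eval (-1) = F.eval 1 + 2 * k := by
  obtain ⟨k, hk⟩ := sub_dvd_eval_sub (-1 : ℤ) 1 F
  exact ⟨-k, by linarith⟩

open QuadraticAlgebra in
theorem norm_gauss_nonneg (x : QuadraticAlgebra ℤ (-1) 0) : 0 ≤ x.norm := by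
  rw [norm_def]; nlinarith [sq_nonneg x.re, sq_nonneg x.im]

open QuadraticAlgebra in
theorem norm_eisenstein_nonneg (x : QuadraticAlgebra ℤ (-1) (-1)) : 0 ≤ x.norm := by
  rw [norm_def]; nlinarith [sq_nonneg (x.re - x.im), sq_nonneg x.re, sq_nonneg x.im]

/-- The value of `𝓡(c)` at a point of order four is a unit if `r(c)` is odd. -/
theorem norm_Rpoly_gaussUnit_eq_one (L : List ℕ) (hL2 : ∀ y ∈ L, 2 ≤ y)
    (h : ¬ 2 ∣ (Rpoly L).eval 1) : (aeval gaussUnit (Rpoly L)).norm = 1 := by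
  have h1 := norm_Rpoly_gaussUnit L hL2
  have h0 := norm_gauss_nonneg (aeval gaussUnit (Rpoly L))
  obtain ⟨k, hk⟩ := exists_re_add_im_aeval_gaussUnit (Rpoly L)
  generalize aeval gaussUnit (Rpoly L) = x at *
  obtain ⟨a, b⟩ := x
  simp only [QuadraticAlgebra.norm_def] at *
  have e : a * a + 0 * a * b - -1 * b * b = (a + b) * (a + b) - 2 * (a * b) := by ring
  rw [e, hk] at h0 h1 ⊢
  obtain ⟨m, hm⟩ : ∃ m, (Rpoly L).eval 1 = 2 * m + 1 := ⟨(Rpoly L).eval 1 / 2, by omega⟩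
  rw [hm] at h0 h1 ⊢
  have e2 : (2 * m + 1 + 2 * k) * (2 * m + 1 + 2 * k) - 2 * (a * b) =
    1 + 2 * (2 * (m + k) * (m + k) + 2 * (m + k) - a * b) := by ring
  rw [e2] at h0 h1 ⊢
  omega

/-- The value of `𝓡(c)` at a primitive cube root of unity is a unit if `3` does not divide
`r(c)`. -/
theorem norm_Rpoly_eisensteinUnit_eq_one (L : List ℕ) (hL2 : ∀ y ∈ L, 2 ≤ y)
    (h : ¬ 3 ∣ (Rpoly L).eval 1) : (aeval eisensteinUnit (Rpoly L)).norm = 1 := by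
  have h1 := norm_Rpoly_eisensteinUnit L hL2
  have h0 := norm_eisenstein_nonneg (aeval eisensteinUnit (Rpoly L))
  obtain ⟨k, hk⟩ := exists_re_add_im_aeval_eisensteinUnit (Rpoly L)
  generalize aeval eisensteinUnit (Rpoly L) = x at *
  obtain ⟨a, b⟩ := x
  simp only [QuadraticAlgebra.norm_def] at *
  by_contra h2
  have h3 : a * a + -1 * a * b - -1 * b * b = 0 := by omega
  have ha : a = 0 := by
    have : a ^ 2 = 0 := by nlinarith [sq_nonneg (a - 2 * b), sq_nonneg a]
    exact pow_eq_zero_iff (by norm_num) |>.1 this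
  have hb : b = 0 := by
    have : b ^ 2 = 0 := by nlinarith
    exact pow_eq_zero_iff (by norm_num) |>.1 this
  omega

theorem Rpoly_eval_neg_one_sq (L : List ℕ) (hL2 : ∀ y ∈ L, 2 ≤ y)
    (h : ¬ 2 ∣ (Rpoly L).eval 1) : (Rpoly L).eval (-1) ^ 2 = 1 := by
  have h1 := Rpoly_eval_neg_one L hL2
  obtain ⟨k, hk⟩ := exists_eval_neg_one (Rpoly L)
  have h2 : (Rpoly L).eval (-1) ≠ 0 := by omega
  have h3 := pow_pos (abs_pos.2 h2) 2
  rw [sq_abs] at h3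
  omega

theorem pow_natDegree_le_eval {F : ℤ[X]} (hF : F.Monic) (h : ∀ n, 0 ≤ F.coeff n) {x : ℤ}
    (hx : 0 ≤ x) : x ^ F.natDegree ≤ F.eval x := by
  rw [eval_eq_sum_range]
  refine le_trans ?_ (Finset.single_le_sum (f := fun i => F.coeff i * x ^ i)
    (fun i _ => mul_nonneg (h i) (pow_nonneg hx i)) (Finset.self_mem_range_succ _))
  simp [hF.coeff_natDegree]

/-- A monic factor of a polynomial with nonnegative coefficients and constant term one is positive
on the nonnegative integers. -/
theorem eval_pos_of_dvd {F f : ℤ[X]} (h : ∀ n, 0 ≤ F.coeff n) (h0 : F.eval 0 = 1)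
    (hf : f.Monic) (hd : f ∣ F) {x : ℤ} (hx : 0 ≤ x) : 0 < f.eval x := by
  set φ : ℝ[X] := f.map (Int.castRingHom ℝ) with hφ
  have hroot : ∀ y : ℝ, 0 ≤ y → φ.eval y ≠ 0 := by
    intro y hy hz
    obtain ⟨g, rfl⟩ := hd
    have hz' : ((f * g).map (Int.castRingHom ℝ)).eval y = 0 := by
      rw [Polynomial.map_mul, eval_mul, ← hφ, hz, zero_mul]
    rw [eval_eq_sum_range, Finset.sum_range_succ'] at hz'
    have h1 : ((f * g).map (Int.castRingHom ℝ)).coeff 0 = 1 := by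
      rw [coeff_map, coeff_zero_eq_eval_zero, h0]; simp
    rw [h1] at hz'
    have h2 : 0 ≤ ∑ k ∈ Finset.range ((f * g).map (Int.castRingHom ℝ)).natDegree,
        ((f * g).map (Int.castRingHom ℝ)).coeff (k + 1) * y ^ (k + 1) := by
      refine Finset.sum_nonneg fun k _ => mul_nonneg ?_ (pow_nonneg hy _)
      rw [coeff_map]
      simpa using h (k + 1)
    simp only [pow_zero] at hz'
    linarith
  have hφm : φ.Monic := hf.map _
  by_contra! hneg
  have hx' : (0 : ℝ) ≤ x := by exact_mod_cast hx
  have hxe : φ.eval (x : ℝ) = (f.eval x : ℤ) := by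
    rw [hφ, eval_intCast_map]; simp
  have hxneg : φ.eval (x : ℝ) ≤ 0 := by rw [hxe]; exact_mod_cast hneg
  obtain ⟨z, hz, hz0⟩ : ∃ z : ℝ, x ≤ z ∧ 0 ≤ φ.eval z := by
    rcases Nat.eq_zero_or_pos φ.natDegree with h' | h'
    · rw [hφm.natDegree_eq_zero.1 h']
      exact ⟨x, le_rfl, by simp⟩
    · have := φ.tendsto_atTop_of_leadingCoeff_nonneg (natDegree_pos_iff_degree_pos.1 h')
        (by rw [hφm.leadingCoeff]; norm_num)
      obtain ⟨z, h1, h2⟩ := ((this.eventually_ge_atTop 0).and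
        (Filter.eventually_ge_atTop (x : ℝ))).exists
      exact ⟨z, h2, h1⟩
  obtain ⟨w, hw, hw0⟩ := intermediate_value_Icc hz φ.continuous.continuousOn ⟨hxneg, hz0⟩
  exact hroot w (hx'.trans hw.1) hw0

/-- The possible values at `1` and `3` of a polynomial `1 + a₁ q + ⋯ + a₅ q⁵ + e q⁶` whose values at
the roots of unity of order two, three and four are units. -/
theorem values_of_units {e a₁ a₂ a₃ a₄ a₅ : ℤ} (he : e = 0 ∨ e = 1)
    (hm : (1 - a₁ + a₂ - a₃ + a₄ - a₅ + e) ^ 2 = 1)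
    (hi : (1 - a₂ + a₄ - e) ^ 2 + (a₁ - a₃ + a₅) ^ 2 = 1)
    (hw : (1 - a₂ + a₃ - a₅ + e) ^ 2 - (1 - a₂ + a₃ - a₅ + e) * (a₁ - a₂ + a₄ - a₅) +
      (a₁ - a₂ + a₄ - a₅) ^ 2 = 1)
    (hpos : 0 < 1 + a₁ * 3 + a₂ * 9 + a₃ * 27 + a₄ * 81 + a₅ * 243 + e * 729) :
    1 + a₁ + a₂ + a₃ + a₄ + a₅ + e ≤ 41 ∧
    (1 + a₁ + a₂ + a₃ + a₄ + a₅ + e = 1 →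
      a₁ = 0 ∧ a₂ = 0 ∧ a₃ = 0 ∧ a₄ = 0 ∧ a₅ = 0 ∧ e = 0) ∧
    ∀ s ∈ List.range (1 + a₁ + a₂ + a₃ + a₄ + a₅ + e).toNat,
      1 + a₁ * 3 + a₂ * 9 + a₃ * 27 + a₄ * 81 + a₅ * 243 + e * 729 ∣
        (valuesAtThree 41 (1 + a₁ + a₂ + a₃ + a₄ + a₅ + e) s).1 →
      (valuesAtThree 41 (1 + a₁ + a₂ + a₃ + a₄ + a₅ + e) s).1 < 6561 := by
  generalize hm' : 1 - a₁ + a₂ - a₃ + a₄ - a₅ + e = m at hm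
  generalize hu : 1 - a₂ + a₄ - e = u at hi
  generalize hv : a₁ - a₃ + a₅ = v at hi
  generalize hs : 1 - a₂ + a₃ - a₅ + e = s at hw
  generalize ht : a₁ - a₂ + a₄ - a₅ = t at hw
  have hm1 : m ∈ [(1 : ℤ), -1] := by
    rcases mul_self_eq_one_iff.1 ((sq m).symm.trans hm) with h | h <;> simp [h]
  have hi1 : (u, v) ∈ [((1 : ℤ), (0 : ℤ)), (-1, 0), (0, 1), (0, -1)] := by
    have h1 : -1 ≤ u := by nlinarith [sq_nonneg v]
    have h2 : u ≤ 1 := by nlinarith [sq_nonneg v]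
    have h3 : -1 ≤ v := by nlinarith [sq_nonneg u]
    have h4 : v ≤ 1 := by nlinarith [sq_nonneg u]
    clear hu hv
    interval_cases u <;> interval_cases v <;> simp_all
  have hw1 : (s, t) ∈ [((1 : ℤ), (0 : ℤ)), (-1, 0), (0, 1), (0, -1), (1, 1), (-1, -1)] := by
    have h1 : -1 ≤ s := by nlinarith [sq_nonneg (s - 2 * t)]
    have h2 : s ≤ 1 := by nlinarith [sq_nonneg (s - 2 * t)]
    have h3 : -1 ≤ t := by nlinarith [sq_nonneg (t - 2 * s)]
    have h4 : t ≤ 1 := by nlinarith [sq_nonneg (t - 2 * s)]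
    clear hs ht
    interval_cases s <;> interval_cases t <;> simp_all
  exact candidate_check e (by rcases he with rfl | rfl <;> simp) m hm1 _ hi1 _ hw1
    a₂ (by simp only [List.mem_singleton]; omega) a₄ (by simp only [List.mem_singleton]; omega)
    a₅ (by simp only [List.mem_singleton]; omega) a₃ (by simp only [List.mem_singleton]; omega)
    a₁ (by simp only [List.mem_singleton]; omega) hpos

theorem eq_sum_of_natDegree_le_six {f : ℤ[X]} (hd : f.natDegree ≤ 6) :
    f = C (f.coeff 0) + C (f.coeff 1) * X + C (f.coeff 2) * X ^ 2 + C (f.coeff 3) * X ^ 3 +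
      C (f.coeff 4) * X ^ 4 + C (f.coeff 5) * X ^ 5 + C (f.coeff 6) * X ^ 6 := by
  conv_lhs => rw [f.as_sum_range_C_mul_X_pow' (n := 7) (by omega)]
  simp [Finset.sum_range_succ]

theorem eq_one_of_nonneg_of_mul_eq_one {a b : ℤ} (ha : 0 ≤ a) (h : a * b = 1) : a = 1 :=
  Int.eq_one_of_dvd_one ha (Dvd.intro b h)

/-- A monic factor of `𝓡(c)` of degree at most six is trivial if its value at `1` is `1`; if instead
its value at `1` is `r(c)`, then `𝓡(c)` is small at `3`. -/
theorem eq_one_or_eval_three_lt_of_dvd (L : List ℕ) (hL : L ≠ []) (hL2 : ∀ y ∈ L, 2 ≤ y)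
    (h2 : ¬ 2 ∣ (Rpoly L).eval 1) (h3 : ¬ 3 ∣ (Rpoly L).eval 1) {f g : ℤ[X]} (hf : f.Monic)
    (hfg : Rpoly L = f * g) (hd : f.natDegree ≤ 6) :
    (f.eval 1 = 1 → f = 1) ∧ (f.eval 1 = (Rpoly L).eval 1 → (Rpoly L).eval 3 < 6561) := by
  have hdvd : f ∣ Rpoly L := ⟨g, hfg⟩
  have hpos {x : ℤ} (hx : 0 ≤ x) : 0 < f.eval x :=
    eval_pos_of_dvd (Rpoly_coeff_nonneg L hL2) (Rpoly_eval_zero L hL2) hf hdvd hx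
  have hz : f.eval 0 = 1 := eq_one_of_nonneg_of_mul_eq_one (b := g.eval 0) (hpos le_rfl).le
    (by rw [← eval_mul, ← hfg, Rpoly_eval_zero L hL2])
  have hm : f.eval (-1) ^ 2 = 1 :=
    eq_one_of_nonneg_of_mul_eq_one (b := g.eval (-1) ^ 2) (sq_nonneg _)
      (by rw [← mul_pow, ← eval_mul, ← hfg, Rpoly_eval_neg_one_sq L hL2 h2])
  have hi : (aeval gaussUnit f).norm = 1 :=
    eq_one_of_nonneg_of_mul_eq_one (b := (aeval gaussUnit g).norm) (norm_gauss_nonneg _)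
      (by rw [← map_mul, ← map_mul, ← hfg, norm_Rpoly_gaussUnit_eq_one L hL2 h2])
  have hw : (aeval eisensteinUnit f).norm = 1 :=
    eq_one_of_nonneg_of_mul_eq_one (b := (aeval eisensteinUnit g).norm)
      (norm_eisenstein_nonneg _)
      (by rw [← map_mul, ← map_mul, ← hfg, norm_Rpoly_eisensteinUnit_eq_one L hL2 h3])
  have hV := hpos (x := 3) (by norm_num)
  have he : f.coeff 6 = 0 ∨ f.coeff 6 = 1 := by
    rcases hd.lt_or_eq with h | h
    · exact .inl (coeff_eq_zero_of_natDegree_lt h)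
    · exact .inr (by rw [← h]; exact hf.coeff_natDegree)
  have hdvd3 : f.eval 3 ∣ (Rpoly L).eval 3 := eval_dvd hdvd
  have hexp := eq_sum_of_natDegree_le_six hd
  have h0 : f.coeff 0 = 1 := by rw [coeff_zero_eq_eval_zero, hz]
  rw [h0] at hexp
  generalize f.coeff 1 = a₁ at *
  generalize f.coeff 2 = a₂ at *
  generalize f.coeff 3 = a₃ at *
  generalize f.coeff 4 = a₄ at *
  generalize f.coeff 5 = a₅ at *
  generalize f.coeff 6 = e at *
  have e1 : f.eval 1 = 1 + a₁ + a₂ + a₃ + a₄ + a₅ + e := by rw [hexp]; simp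
  have e3 : f.eval 3 = 1 + a₁ * 3 + a₂ * 9 + a₃ * 27 + a₄ * 81 + a₅ * 243 + e * 729 := by
    rw [hexp]; norm_num
  have em : f.eval (-1) = 1 - a₁ + a₂ - a₃ + a₄ - a₅ + e := by rw [hexp]; simp; ring
  have ei : aeval gaussUnit f = ⟨1 - a₂ + a₄ - e, a₁ - a₃ + a₅⟩ := by
    rw [hexp]
    ext <;> simp [pow_succ, QuadraticAlgebra.re_one, QuadraticAlgebra.im_one] <;> ring
  have ew : aeval eisensteinUnit f = ⟨1 - a₂ + a₃ - a₅ + e, a₁ - a₂ + a₄ - a₅⟩ := by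
    rw [hexp]
    ext <;> simp [pow_succ, QuadraticAlgebra.re_one, QuadraticAlgebra.im_one] <;> ring
  rw [em] at hm
  rw [ei, QuadraticAlgebra.norm_def] at hi
  rw [ew, QuadraticAlgebra.norm_def] at hw
  rw [e3] at hV hdvd3
  have key := values_of_units he (a₁ := a₁) (a₂ := a₂) (a₃ := a₃) (a₄ := a₄) (a₅ := a₅)
    (by linarith) (by linarith) (by linarith) hV
  rw [← e1] at key
  obtain ⟨k1, k2, k3⟩ := key
  refine ⟨fun h => ?_, fun h => ?_⟩
  · obtain ⟨rfl, rfl, rfl, rfl, rfl, rfl⟩ := k2 h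
    simpa using hexp
  · rw [h] at k1 k3
    obtain ⟨l1, l2, l3⟩ := Rpoly_eval_three L hL hL2 41 (by exact_mod_cast k1)
    have k4 := k3 ((Spoly L).eval 1).toNat (by rw [List.mem_range]; omega)
    rw [Int.toNat_of_nonneg l1, ← l3] at k4
    exact k4 hdvd3

theorem seven_le_natDegree_of_mul_eq (L : List ℕ) (hL2 : ∀ y ∈ L, 2 ≤ y) (p : ℕ) (hp : p.Prime)
    (hs : (Rpoly L).eval 1 = p) {f g : ℤ[X]} (hf : f.Monic) (hg : g.Monic)
    (hfg : Rpoly L = f * g) (hf1 : 1 ≤ f.natDegree) (hg1 : 1 ≤ g.natDegree) :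
    7 ≤ f.natDegree := by
  have hL : L ≠ [] := by
    rintro rfl
    rw [Rpoly_nil, eval_one] at hs
    exact hp.one_lt.ne (by exact_mod_cast hs)
  have hdeg : (Rpoly L).natDegree = f.natDegree + g.natDegree := by
    rw [hfg, hf.natDegree_mul hg]
  have hge := pow_natDegree_le_eval (Rpoly_monic L hL2) (Rpoly_coeff_nonneg L hL2)
    (x := 3) (by norm_num)
  rw [hdeg] at hge
  have hdf : f ∣ Rpoly L := ⟨g, hfg⟩
  have hgf : Rpoly L = g * f := by rw [hfg, mul_comm]
  have hpos {x : ℤ} (hx : 0 ≤ x) : 0 < f.eval x :=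
    eval_pos_of_dvd (Rpoly_coeff_nonneg L hL2) (Rpoly_eval_zero L hL2) hf hdf hx
  have mono {n : ℕ} (hn : n ≤ f.natDegree + g.natDegree) : (3 : ℤ) ^ n ≤ (Rpoly L).eval 3 :=
    (pow_le_pow_right₀ (by norm_num) hn).trans hge
  have hp2 := hp.two_le
  by_cases h2 : p = 2
  · subst h2
    obtain ⟨l1, l2, l3⟩ := Rpoly_eval_three L hL hL2 2 hs.le
    have := mono (n := 2) (by omega)
    rw [hs] at l2 l3
    generalize (Spoly L).eval 1 = s at *
    rw [l3] at this
    push_cast at *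
    interval_cases s <;> exact absurd this (by decide)
  by_cases h3 : p = 3
  · subst h3
    obtain ⟨l1, l2, l3⟩ := Rpoly_eval_three L hL hL2 3 hs.le
    rw [hs] at l2 l3
    have h13 : (Rpoly L).eval 3 ≤ 13 := by
      generalize (Spoly L).eval 1 = s at *
      rw [l3]
      push_cast at *
      interval_cases s <;> decide
    have hd1 : f.natDegree = 1 := by
      by_contra hne
      have := mono (n := 3) (by omega)
      omega
    have hX := hf.eq_X_add_C hd1
    have hz : f.eval 0 = 1 :=
      eq_one_of_nonneg_of_mul_eq_one (b := g.eval 0) (hpos le_rfl).le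
        (by rw [← eval_mul, ← hfg, Rpoly_eval_zero L hL2])
    rw [← coeff_zero_eq_eval_zero] at hz
    rw [hz] at hX
    have h4 : f.eval 3 = 4 := by rw [hX]; norm_num
    have h5 := eval_dvd (x := (3 : ℤ)) hdf
    have h9 := mono (n := 2) (by omega)
    rw [h4] at h5
    have : (Rpoly L).eval 3 = 13 ∨ (Rpoly L).eval 3 < 9 := by
      generalize (Spoly L).eval 1 = s at *
      rw [l3]
      push_cast at *
      interval_cases s <;> decide
    omega
  have h2' : ¬ (2 : ℤ) ∣ (Rpoly L).eval 1 := by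
    rw [hs]
    intro h
    exact h2 ((Nat.prime_dvd_prime_iff_eq Nat.prime_two hp).1 (by exact_mod_cast h)).symm
  have h3' : ¬ (3 : ℤ) ∣ (Rpoly L).eval 1 := by
    rw [hs]
    intro h
    exact h3 ((Nat.prime_dvd_prime_iff_eq Nat.prime_three hp).1 (by exact_mod_cast h)).symm
  by_contra! hlt
  obtain ⟨k1, k2⟩ := eq_one_or_eval_three_lt_of_dvd L hL hL2 h2' h3' hf hfg (by omega)
  have hf_ne : f.eval 1 ≠ 1 := fun h => by simp [k1 h] at hf1
  have hmul : f.eval 1 * g.eval 1 = p := by rw [← eval_mul, ← hfg, hs]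
  have hfp : f.eval 1 = p := by
    have h1 := hpos (x := 1) (by norm_num)
    lift f.eval 1 to ℕ using h1.le with a
    have hd : a ∣ p := by
      have : (a : ℤ) ∣ p := ⟨_, hmul.symm⟩
      exact_mod_cast this
    rcases (Nat.dvd_prime hp).1 hd with h | h
    · exact absurd (by exact_mod_cast h) hf_ne
    · exact_mod_cast h
  have hg_one : g.eval 1 = 1 := by
    rw [hfp] at hmul
    have : (p : ℤ) ≠ 0 := by exact_mod_cast hp.ne_zero
    exact mul_left_cancel₀ this (by rw [hmul, mul_one])
  have hg7 : 7 ≤ g.natDegree := by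
    by_contra! hlt'
    have := (eq_one_or_eval_three_lt_of_dvd L hL hL2 h2' h3' hg hgf (by omega)).1 hg_one
    simp [this] at hg1
  have := mono (n := 8) (by omega)
  have := k2 (by rw [hfp, hs])
  omega

/-- If `p` is prime, `s(L) = p`, and `𝓢(L)` factors over `ℚ` as a product of two
polynomials of degree ≥ 1, then both factors have degree at least 7. -/
theorem stmt18 (p : ℕ) (hp : p.Prime)
    (L : List ℕ) (hL : L ≠ []) (hL2 : ∀ y ∈ L, 2 ≤ y)
    (hs : sNum L = (p : ℤ))
    (f g : Polynomial ℚ) (hf : 1 ≤ f.natDegree) (hg : 1 ≤ g.natDegree)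
    (hfg : (Spoly L).map (Int.castRingHom ℚ) = f * g) :
    7 ≤ f.natDegree ∧ 7 ≤ g.natDegree := by
  obtain ⟨c, L, rfl⟩ := List.exists_cons_of_ne_nil hL
  have hL2' : ∀ y ∈ L, 2 ≤ y := fun y hy => hL2 y (by simp [hy])
  rw [sNum, Spoly_cons] at hs
  rw [Spoly_cons] at hfg
  have hR := Rpoly_monic L hL2'
  have hf0 : f ≠ 0 := fun h => by simp [h] at hf
  have hg0 : g ≠ 0 := fun h => by simp [h] at hg
  have hlf : f.leadingCoeff ≠ 0 := leadingCoeff_ne_zero.2 hf0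
  have hlc : f.leadingCoeff * g.leadingCoeff = 1 := by
    rw [← leadingCoeff_mul, ← hfg, (hR.map _).leadingCoeff]
  obtain ⟨f', hf'⟩ := IsIntegrallyClosed.eq_map_mul_C_of_dvd ℚ hR (g := f) ⟨g, hfg⟩
  obtain ⟨g', hg'⟩ := IsIntegrallyClosed.eq_map_mul_C_of_dvd ℚ hR (g := g)
    ⟨f, by rw [mul_comm]; exact hfg⟩
  have hinj : Function.Injective (algebraMap ℤ ℚ) := Int.cast_injective
  have monic_of {φ : ℚ[X]} {φ' : ℤ[X]} (h0 : φ ≠ 0)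
      (h : φ'.map (algebraMap ℤ ℚ) * C φ.leadingCoeff = φ) :
      φ'.Monic ∧ φ'.natDegree = φ.natDegree := by
    have hl := leadingCoeff_ne_zero.2 h0
    have h1 := congrArg leadingCoeff h
    rw [leadingCoeff_mul, leadingCoeff_C] at h1
    refine ⟨monic_of_injective hinj (mul_right_cancel₀ hl (by rw [h1, one_mul])), ?_⟩
    have h2 := congrArg natDegree h
    rwa [natDegree_mul_C hl, natDegree_map_eq_of_injective hinj] at h2
  obtain ⟨hfm, hfd⟩ := monic_of hf0 hf'
  obtain ⟨hgm, hgd⟩ := monic_of hg0 hg'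
  have hmul : Rpoly L = f' * g' := by
    refine map_injective (algebraMap ℤ ℚ) hinj ?_
    have h1 : f * g = f'.map (algebraMap ℤ ℚ) * g'.map (algebraMap ℤ ℚ) := by
      conv_lhs => rw [← hf', ← hg', mul_mul_mul_comm, ← C_mul, hlc, C_1, mul_one]
    rw [Polynomial.map_mul, ← h1]
    exact hfg
  rw [← hfd] at hf ⊢
  rw [← hgd] at hg ⊢
  exact ⟨seven_le_natDegree_of_mul_eq L hL2' p hp hs hfm hgm hmul hf hg,
    seven_le_natDegree_of_mul_eq L hL2' p hp hs hgm hfm (by rw [hmul, mul_comm]) hg hf⟩
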